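/- arXiv:2507.01027 — 2 statements merged into one kernel-verified Lean document; each statement's English description precedes it below -/
import Mathlib

section
/- (Theorem 1, case of scaling up small values.) Under the part-1 setup, let m > 1 be a real number with m·b_j ≤ A/n for every j, let x ∈ ℝⁿ be the constant vector with every entry 2, let x_new ∈ ℝⁿ have entries 2 at positions i ≤ k and 2/m at positions i > k, and let w_new ∈ ℝⁿ have first k entries a_1, …, a_k and last n−k entries m·b_1, …, m·b_{n−k}. Then ⟨x, deq(w)⟩ < ⟨x_new, deq(w_new)⟩ < 2A = ⟨x, w⟩, and consequently the quantization error strictly decreases: |⟨x, w⟩ − ⟨x_new, deq(w_new)⟩| < |⟨x, w⟩ − ⟨x, deq(w)⟩|. -/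
open Finset

/-- Binarization shift: `β(w) = (1/n)·Σ_i w_i`. -/
noncomputable def bShift {n : ℕ} (w : Fin n → ℝ) : ℝ :=
  (1 / (n : ℝ)) * ∑ i, w i

/-- Binarization scale: `α(w) = (1/n)·Σ_i |w_i − β(w)|`. -/
noncomputable def bScale {n : ℕ} (w : Fin n → ℝ) : ℝ :=
  (1 / (n : ℝ)) * ∑ i, |w i - bShift w|

/-- Sign function: `+1` if `t > 0`, `−1` if `t ≤ 0`. -/
noncomputable def bSign (t : ℝ) : ℝ :=
  if t > 0 then 1 else -1

/-- Dequantized vector: `deq(w)_i = α(w)·Sign(w_i − β(w)) + β(w)`. -/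
noncomputable def bDeq {n : ℕ} (w : Fin n → ℝ) : Fin n → ℝ :=
  fun i => bScale w * bSign (w i - bShift w) + bShift w

theorem sum_fin_eq_sum_add_sum {n k : ℕ} (hkn : k ≤ n) (f : Fin n → ℝ) :
    ∑ i, f i = ∑ i : Fin k, f ⟨i, by omega⟩ + ∑ j : Fin (n - k), f ⟨k + j, by omega⟩ := by
  obtain ⟨l, rfl⟩ := Nat.exists_eq_add_of_le hkn
  rw [Fin.sum_univ_add]
  congr 1
  exact Fintype.sum_equiv (finCongr (by omega)) _ _ fun j => rfl

/-- Binarization of a vector with large leading entries summing to `A` and small trailing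
entries summing to zero. -/
theorem bDeq_of_large_of_small {n k : ℕ} (hkn : k < n) {A : ℝ}
    {a : Fin k → ℝ} (hasum : ∑ i, a i = A) (halarge : ∀ i, A / n < a i)
    {b : Fin (n - k) → ℝ} (hbsum : ∑ j, b j = 0) (hbsmall : ∀ j, b j ≤ A / n)
    {w : Fin n → ℝ} (hw1 : ∀ i : Fin k, w ⟨i, by omega⟩ = a i)
    (hw2 : ∀ j : Fin (n - k), w ⟨k + j, by omega⟩ = b j) :
    (∀ i : Fin k, bDeq w ⟨i, by omega⟩ = A / n + 2 * A * (n - k) / n ^ 2) ∧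
      ∀ j : Fin (n - k), bDeq w ⟨k + j, by omega⟩ = A / n - 2 * A * (n - k) / n ^ 2 := by
  have hn : (n : ℝ) ≠ 0 := by
    have : n ≠ 0 := by omega
    exact_mod_cast this
  have hshift : bShift w = A / n := by
    rw [bShift, sum_fin_eq_sum_add_sum hkn.le]
    simp only [hw1, hw2, hasum, hbsum]
    ring
  have hscale : bScale w = 2 * A * (n - k) / n ^ 2 := by
    rw [bScale, sum_fin_eq_sum_add_sum hkn.le, hshift]
    simp only [hw1, hw2, abs_of_pos (sub_pos.2 (halarge _)),
      abs_of_nonpos (sub_nonpos.2 (hbsmall _)), neg_sub, Finset.sum_sub_distrib, hasum, hbsum,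
      Finset.sum_const, Finset.card_univ, Fintype.card_fin, nsmul_eq_mul, Nat.cast_sub hkn.le]
    field_simp
    ring
  constructor
  · intro i
    rw [bDeq, hshift, hscale, hw1, bSign, if_pos (sub_pos.2 (halarge i))]
    ring
  · intro j
    rw [bDeq, hshift, hscale, hw2, bSign, if_neg (sub_nonpos.2 (hbsmall j)).not_gt]
    ring

theorem stmt_9 (n k : ℕ) (hk : 1 ≤ k) (hkn : 2 * k < n)
    (A : ℝ) (hA : 0 < A)
    (a : Fin k → ℝ) (hasum : ∑ i, a i = A) (halarge : ∀ i, A / n < a i)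
    (b : Fin (n - k) → ℝ) (hbsum : ∑ j, b j = 0) (hbsmall : ∀ j, b j ≤ A / n)
    (w : Fin n → ℝ)
    (hw1 : ∀ i : Fin k, w ⟨i, by omega⟩ = a i)
    (hw2 : ∀ j : Fin (n - k), w ⟨k + j, by omega⟩ = b j)
    (m : ℝ) (hm : 1 < m) (hmb : ∀ j, m * b j ≤ A / n)
    (wnew : Fin n → ℝ)
    (hwn1 : ∀ i : Fin k, wnew ⟨i, by omega⟩ = a i)
    (hwn2 : ∀ j : Fin (n - k), wnew ⟨k + j, by omega⟩ = m * b j)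
    (x : Fin n → ℝ) (hx : ∀ i, x i = 2)
    (xnew : Fin n → ℝ)
    (hxn1 : ∀ i : Fin n, (i : ℕ) < k → xnew i = 2)
    (hxn2 : ∀ i : Fin n, k ≤ (i : ℕ) → xnew i = 2 / m) :
    (∑ i, x i * bDeq w i) < (∑ i, xnew i * bDeq wnew i) ∧
      (∑ i, xnew i * bDeq wnew i) < 2 * A ∧
      (∑ i, x i * w i) = 2 * A ∧
      |(∑ i, x i * w i) - (∑ i, xnew i * bDeq wnew i)| <
        |(∑ i, x i * w i) - (∑ i, x i * bDeq w i)| := by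
  obtain ⟨hd1, hd2⟩ := bDeq_of_large_of_small (by omega) hasum halarge hbsum hbsmall hw1 hw2
  obtain ⟨he1, he2⟩ := bDeq_of_large_of_small (by omega) hasum halarge
    (b := fun j => m * b j) (by rw [← Finset.mul_sum, hbsum, mul_zero]) hmb hwn1 hwn2
  have hkn' : k ≤ n := by omega
  have hk0 : (0 : ℝ) < k := by exact_mod_cast hk
  have hknR : 2 * (k : ℝ) < n := by exact_mod_cast hkn
  have hn0 : (0 : ℝ) < n := by linarith
  have hxw : ∑ i, x i * w i = 2 * A := by
    simp only [hx, ← Finset.mul_sum]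
    rw [sum_fin_eq_sum_add_sum hkn']
    simp only [hw1, hw2, hasum, hbsum, add_zero]
  have hold : ∑ i, x i * bDeq w i = k * (2 * (A / n + 2 * A * (n - k) / n ^ 2)) +
      (n - k) * (2 * (A / n - 2 * A * (n - k) / n ^ 2)) := by
    rw [sum_fin_eq_sum_add_sum hkn']
    simp only [hx, hd1, hd2, Finset.sum_const, Finset.card_univ, Fintype.card_fin,
      nsmul_eq_mul, Nat.cast_sub hkn']
  have hnew : ∑ i, xnew i * bDeq wnew i = k * (2 * (A / n + 2 * A * (n - k) / n ^ 2)) +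
      (n - k) * (2 / m * (A / n - 2 * A * (n - k) / n ^ 2)) := by
    have h1 : ∀ i : Fin k, xnew ⟨i, by omega⟩ = 2 := fun i => hxn1 _ i.2
    have h2 : ∀ j : Fin (n - k), xnew ⟨k + j, by omega⟩ = 2 / m :=
      fun j => hxn2 _ (Nat.le_add_right k j)
    rw [sum_fin_eq_sum_add_sum hkn']
    simp only [h1, h2, he1, he2, Finset.sum_const, Finset.card_univ, Fintype.card_fin,
      nsmul_eq_mul, Nat.cast_sub hkn']
  have hneg : (n - k) * (A / n - 2 * A * (n - k) / n ^ 2) < 0 := by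
    have h : A / n - 2 * A * (n - k) / n ^ 2 = -(A * (n - 2 * k) / n ^ 2) := by
      field_simp
      ring
    have hpos : 0 < A * (n - 2 * k) / (n : ℝ) ^ 2 :=
      div_pos (mul_pos hA (by linarith)) (by positivity)
    rw [h]
    exact mul_neg_of_pos_of_neg (by linarith) (neg_neg_of_pos hpos)
  have htop : k * (2 * (A / n + 2 * A * (n - k) / n ^ 2)) < 2 * A := by
    have h : 2 * A - k * (2 * (A / n + 2 * A * (n - k) / n ^ 2)) =
        2 * A * ((n - 2 * k) * (n - k)) / n ^ 2 := by
      field_simp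
      ring
    have hpos : 0 < 2 * A * ((n - 2 * k) * (n - k)) / (n : ℝ) ^ 2 :=
      div_pos (mul_pos (by linarith) (mul_pos (by linarith) (by linarith))) (by positivity)
    linarith
  have hm0 : 0 < 2 / m := by positivity
  have hm2 : 2 / m < 2 := div_lt_self two_pos hm
  have hlt : ∑ i, x i * bDeq w i < ∑ i, xnew i * bDeq wnew i := by
    rw [hold, hnew]
    nlinarith [mul_lt_mul_of_neg_right hm2 hneg]
  have hub : ∑ i, xnew i * bDeq wnew i < 2 * A := by
    rw [hnew]
    nlinarith [mul_neg_of_pos_of_neg hm0 hneg]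
  refine ⟨hlt, hub, hxw, ?_⟩
  rw [hxw, abs_of_pos (by linarith), abs_of_pos (by linarith)]
  linarith
end

section
/- Under the part-2 setup, let x ∈ ℝⁿ be the constant vector with every entry 1, let x_new ∈ ℝⁿ have entries m at positions i ≤ k and 1 at positions i > k, and let w_new ∈ ℝⁿ have first k entries a_1, …, a_k and last n−k entries b_1, …, b_{n−k}. Then the gain in quantized output from scaling down the large entries equals ⟨x_new, deq(w_new)⟩ − ⟨x, deq(w)⟩ = (m−1)(n−k)(n−2k)A/n², which is strictly positive. -/
open Finset

/-- A sum over `Fin n` splits at `k` into its first `k` and last `n - k` terms. -/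
theorem sum_fin_split {n k : ℕ} (hk : k ≤ n) (f : Fin n → ℝ) :
    ∑ i, f i = ∑ i : Fin k, f ⟨i, by omega⟩ + ∑ j : Fin (n - k), f ⟨k + j, by omega⟩ := by
  obtain ⟨l, rfl⟩ := Nat.exists_eq_add_of_le hk
  rw [Fin.sum_univ_add]
  congr 1
  exact (Fintype.sum_equiv (finCongr (Nat.add_sub_cancel_left (n := k) (m := l))) _ _ (fun _ => rfl)).symm

/-- The inner product of `bDeq v` with a vector equal to `s` on the first `k` entries and `1` on the
others, when exactly the first `k` entries of `v` exceed its shift `c * A / n`. -/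
theorem sum_mul_bDeq {n k : ℕ} (hk : k ≤ n) (hn : 0 < n) {A c s : ℝ} (hA : 0 ≤ A) (hc : 1 ≤ c)
    (a : Fin k → ℝ) (hasum : ∑ i, a i = A) (halarge : ∀ i, A / n < a i)
    (b : Fin (n - k) → ℝ) (hbsum : ∑ j, b j = 0) (hbsmall : ∀ j, b j ≤ A / n)
    (v : Fin n → ℝ)
    (hv1 : ∀ i : Fin k, v ⟨i, by omega⟩ = c * a i)
    (hv2 : ∀ j : Fin (n - k), v ⟨k + j, by omega⟩ = b j)
    (y : Fin n → ℝ)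
    (hy1 : ∀ i : Fin n, (i : ℕ) < k → y i = s)
    (hy2 : ∀ i : Fin n, k ≤ (i : ℕ) → y i = 1) :
    ∑ i, y i * bDeq v i =
      k * s * (c * A / n * (2 * (n - k) / n) + c * A / n) +
        (n - k) * (c * A / n - c * A / n * (2 * (n - k) / n)) := by
  have hn' : (0 : ℝ) < n := by exact_mod_cast hn
  have hshift : bShift v = c * A / n := by
    rw [bShift, sum_fin_split hk]
    simp only [hv1, hv2, ← Finset.mul_sum, hasum, hbsum]
    ring
  have htop (i : Fin k) : 0 < c * a i - c * A / n := by
    rw [mul_div_assoc, ← mul_sub]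
    exact mul_pos (by linarith) (sub_pos.2 (halarge i))
  have hbot (j : Fin (n - k)) : b j - c * A / n ≤ 0 := by
    have h := le_mul_of_one_le_left (div_nonneg hA hn'.le) hc
    rw [mul_div_assoc]
    linarith [hbsmall j]
  have hscale : bScale v = c * A / n * (2 * (n - k) / n) := by
    rw [bScale, sum_fin_split hk, hshift]
    simp only [hv1, hv2, abs_of_pos (htop _), abs_of_nonpos (hbot _), Finset.sum_sub_distrib,
      Finset.sum_neg_distrib, ← Finset.mul_sum, hasum, hbsum, Finset.sum_const, Finset.card_univ,
      Fintype.card_fin, nsmul_eq_mul, Nat.cast_sub hk]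
    field_simp
    ring
  have htop_sign (i : Fin k) : bSign (c * a i - c * A / n) = 1 := if_pos (htop i)
  have hbot_sign (j : Fin (n - k)) : bSign (b j - c * A / n) = -1 := if_neg (hbot j).not_gt
  have hy_top (i : Fin k) : y ⟨i, by omega⟩ = s := hy1 _ i.is_lt
  have hy_bot (j : Fin (n - k)) : y ⟨k + j, by omega⟩ = 1 := hy2 _ (Nat.le_add_right _ _)
  rw [sum_fin_split hk]
  simp only [bDeq, hshift, hscale, hv1, hv2, htop_sign, hbot_sign, hy_top, hy_bot,
    Finset.sum_const, Finset.card_univ, Fintype.card_fin, nsmul_eq_mul,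
    Nat.cast_sub hk]
  ring

theorem stmt_14 (n k : ℕ) (hk : 1 ≤ k) (hkn : 2 * k < n)
    (A : ℝ) (hA : 0 < A) (m : ℝ) (hm : 1 < m)
    (a : Fin k → ℝ) (hasum : ∑ i, a i = A) (halarge : ∀ i, A / n < a i)
    (b : Fin (n - k) → ℝ) (hbsum : ∑ j, b j = 0) (hbsmall : ∀ j, b j ≤ A / n)
    (w : Fin n → ℝ)
    (hw1 : ∀ i : Fin k, w ⟨i, by omega⟩ = m * a i)
    (hw2 : ∀ j : Fin (n - k), w ⟨k + j, by omega⟩ = b j)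
    (wnew : Fin n → ℝ)
    (hwn1 : ∀ i : Fin k, wnew ⟨i, by omega⟩ = a i)
    (hwn2 : ∀ j : Fin (n - k), wnew ⟨k + j, by omega⟩ = b j)
    (x : Fin n → ℝ) (hx : ∀ i, x i = 1)
    (xnew : Fin n → ℝ)
    (hxn1 : ∀ i : Fin n, (i : ℕ) < k → xnew i = m)
    (hxn2 : ∀ i : Fin n, k ≤ (i : ℕ) → xnew i = 1) :
    (∑ i, xnew i * bDeq wnew i) - (∑ i, x i * bDeq w i) =
        (m - 1) * ((n : ℝ) - k) * ((n : ℝ) - 2 * k) * A / (n : ℝ) ^ 2 ∧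
      0 < (m - 1) * ((n : ℝ) - k) * ((n : ℝ) - 2 * k) * A / (n : ℝ) ^ 2 := by
  have hn : (0 : ℝ) < n := by exact_mod_cast (by omega : 0 < n)
  have hkn' : (2 : ℝ) * k < n := by exact_mod_cast hkn
  have hk0 : (0 : ℝ) ≤ k := k.cast_nonneg
  constructor
  · rw [sum_mul_bDeq (by omega) (by omega) hA.le le_rfl a hasum halarge b hbsum hbsmall wnew
        (by simpa using hwn1) hwn2 xnew hxn1 hxn2,
      sum_mul_bDeq (by omega) (by omega) hA.le hm.le a hasum halarge b hbsum hbsmall w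
        hw1 hw2 x (fun i _ => hx i) (fun i _ => hx i)]
    field_simp
    ring
  · have h1 : 0 < m - 1 := by linarith
    have h2 : (0 : ℝ) < n - k := by linarith
    have h3 : (0 : ℝ) < n - 2 * k := by linarith
    positivity
end
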